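/- Let T, V be bounded linear invertible operators on a complex Hilbert space H. Then for every x ∈ H with x ≠ 0 and every ν ∈ [0,1], in the operator order: T Ⓢ_ν V ≤ (1−ν)·(‖Vx‖²/‖Tx‖²)^ν·|T|² + ν·(‖Tx‖²/‖Vx‖²)^{1−ν}·|V|². -/

import Mathlib

variable {H : Type*} [NormedAddCommGroup H] [InnerProductSpace ℂ H] [CompleteSpace H]

/-- `X = |VT⁻¹|² = (T*)⁻¹ V* V T⁻¹`. -/
noncomputable def qX (V T : (H →L[ℂ] H)ˣ) : H →L[ℂ] H :=
  star (↑(T⁻¹) : H →L[ℂ] H) * (star (V : H →L[ℂ] H) * (V : H →L[ℂ] H)) * (↑(T⁻¹) : H →L[ℂ] H)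

/-- The quadratic operator perspective `⊙_Φ(V,T) = T* Φ(X) T`. -/
noncomputable def qPersp (Φ : ℝ → ℝ) (V T : (H →L[ℂ] H)ˣ) : H →L[ℂ] H :=
  star (T : H →L[ℂ] H) * cfc Φ (qX V T) * (T : H →L[ℂ] H)

/-- `|T|² = T*T`. -/
noncomputable def modSq (T : (H →L[ℂ] H)ˣ) : H →L[ℂ] H :=
  star (T : H →L[ℂ] H) * (T : H →L[ℂ] H)

/-- The power function `s ↦ s ^ ν` lies below its tangent line at `a`. -/
theorem rpow_le_tangent {a s ν : ℝ} (ha : 0 < a) (hs : 0 ≤ s) (hν : ν ∈ Set.Icc (0 : ℝ) 1) :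
    s ^ ν ≤ (1 - ν) * a ^ ν + ν * a⁻¹ ^ (1 - ν) * s := by
  have h := Real.geom_mean_le_arith_mean2_weighted (sub_nonneg.2 hν.2) hν.1
    (Real.rpow_nonneg ha.le ν)
    (mul_nonneg (Real.rpow_nonneg (inv_nonneg.2 ha.le) (1 - ν)) hs) (by ring)
  rw [Real.mul_rpow (Real.rpow_nonneg (inv_nonneg.2 ha.le) _) hs, ← Real.rpow_mul ha.le,
    ← Real.rpow_mul (inv_nonneg.2 ha.le), Real.inv_rpow ha.le, mul_comm ν (1 - ν), ← mul_assoc,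
    mul_inv_cancel₀ (Real.rpow_pos_of_pos ha _).ne', one_mul] at h
  linarith

theorem qX_eq (V T : (H →L[ℂ] H)ˣ) :
    qX V T = star ((V : H →L[ℂ] H) * (↑(T⁻¹) : H →L[ℂ] H)) *
      ((V : H →L[ℂ] H) * (↑(T⁻¹) : H →L[ℂ] H)) := by
  simp only [qX, star_mul, mul_assoc]

theorem qX_nonneg (V T : (H →L[ℂ] H)ˣ) : 0 ≤ qX V T := by
  rw [qX_eq]
  exact star_mul_self_nonneg _

theorem star_mul_qX_mul (V T : (H →L[ℂ] H)ˣ) :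
    star (T : H →L[ℂ] H) * qX V T * (T : H →L[ℂ] H) = modSq V := by
  have h : (V : H →L[ℂ] H) * (↑(T⁻¹) : H →L[ℂ] H) * (T : H →L[ℂ] H) = V := by
    rw [mul_assoc, Units.inv_mul, mul_one]
  rw [qX_eq, ← mul_assoc, ← star_mul, h, mul_assoc, h, modSq]

theorem units_apply_ne_zero {E : Type*} [NormedAddCommGroup E] [NormedSpace ℂ E]
    (T : (E →L[ℂ] E)ˣ) {x : E} (hx : x ≠ 0) :
    (T : E →L[ℂ] E) x ≠ 0 := by
  intro h
  apply hx
  have h1 : ((↑(T⁻¹) : E →L[ℂ] E) * (T : E →L[ℂ] E)) x = x := by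
    rw [Units.inv_mul, one_apply_eq_self]
  rw [← h1, mul_apply_eq_comp, h, map_zero]

/-- The quadratic operator perspective is bounded above by any affine majorant of `Φ`. -/
theorem qPersp_le_of_le_affine {Φ : ℝ → ℝ} (hΦ : Continuous Φ) {c d : ℝ}
    (h : ∀ s, 0 ≤ s → Φ s ≤ c + d * s) (V T : (H →L[ℂ] H)ˣ) :
    qPersp Φ V T ≤ c • modSq T + d • modSq V := by
  have hX := qX_nonneg V T
  have hle : cfc Φ (qX V T) ≤ cfc (fun s : ℝ => c + d * s) (qX V T) :=
    cfc_mono (fun s hs => h s (spectrum_nonneg_of_nonneg hX hs)) hΦ.continuousOn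
      (by fun_prop)
  have haff : cfc (fun s : ℝ => c + d * s) (qX V T) = c • 1 + d • qX V T := by
    rw [cfc_const_add c (fun s : ℝ => d * s) (qX V T), cfc_const_mul_id d (qX V T),
      Algebra.algebraMap_eq_smul_one]
  rw [haff] at hle
  refine (star_left_conjugate_le_conjugate hle (T : H →L[ℂ] H)).trans_eq ?_
  rw [mul_add, add_mul, mul_smul_comm, smul_mul_assoc, mul_one, mul_smul_comm, smul_mul_assoc,
    star_mul_qX_mul, ← modSq]

theorem stmt14 (T V : (H →L[ℂ] H)ˣ) (x : H) (hx : x ≠ 0)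
    (ν : ℝ) (hν : ν ∈ Set.Icc (0 : ℝ) 1) :
    qPersp (fun s : ℝ => s ^ ν) V T ≤
      ((1 - ν) * (‖(V : H →L[ℂ] H) x‖ ^ 2 / ‖(T : H →L[ℂ] H) x‖ ^ 2) ^ ν) • modSq T +
        (ν * (‖(T : H →L[ℂ] H) x‖ ^ 2 / ‖(V : H →L[ℂ] H) x‖ ^ 2) ^ (1 - ν)) • modSq V := by
  have hT := norm_pos_iff.2 (units_apply_ne_zero T hx)
  have hV := norm_pos_iff.2 (units_apply_ne_zero V hx)
  rw [← inv_div (‖(V : H →L[ℂ] H) x‖ ^ 2)]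
  exact qPersp_le_of_le_affine (Real.continuous_rpow_const hν.1)
    (fun s hs => rpow_le_tangent (by positivity) hs hν) V T
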